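/- arXiv:1806.01149 — 5 statements merged into one kernel-verified Lean document; each statement's English description precedes it below -/
import Mathlib

section
/- Let p be a prime number. For every positive integer n, ∑_{k : p·k ≤ n} φ(p·k) = (p−1)·∑_{m=1}^{⌊n/p⌋} φ(m) + ∑_{k : p·k ≤ ⌊n/p⌋} φ(p·k). -/
open Finset

theorem Nat.totient_prime_mul_eq {p : ℕ} (hp : p.Prime) (k : ℕ) :
    Nat.totient (p * k) = (p - 1) * Nat.totient k + if p ∣ k then Nat.totient k else 0 := by
  split_ifs with h
  · rw [Nat.totient_mul_of_prime_of_dvd hp h, ← Nat.succ_mul, Nat.succ_eq_add_one,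
      Nat.sub_add_cancel hp.one_le]
  · rw [Nat.totient_mul_of_prime_of_not_dvd hp h, add_zero]

theorem Finset.sum_Icc_filter_dvd {M : Type*} [AddCommMonoid M] {p : ℕ} (hp : 0 < p) (N : ℕ)
    (f : ℕ → M) :
    ∑ k ∈ Icc 1 N with p ∣ k, f k = ∑ k ∈ Icc 1 (N / p), f (p * k) := by
  symm
  refine sum_nbij (p * ·) ?_ (fun a _ b _ h => Nat.eq_of_mul_eq_mul_left hp h) ?_ (fun _ _ => rfl)
  · intro k hk
    rw [mem_Icc, Nat.le_div_iff_mul_le hp, mul_comm] at hk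
    exact mem_filter.2 ⟨mem_Icc.2 ⟨Nat.mul_pos hp hk.1, hk.2⟩, dvd_mul_right p k⟩
  · intro k hk
    obtain ⟨hk, j, rfl⟩ := mem_filter.1 (mem_coe.1 hk)
    rw [mem_Icc] at hk
    refine ⟨j, mem_coe.2 (mem_Icc.2 ⟨Nat.pos_of_mul_pos_left hk.1, ?_⟩), rfl⟩
    rw [Nat.le_div_iff_mul_le hp, mul_comm]
    exact hk.2

theorem phi_sum_multiples_recursion (p : ℕ) (hp : p.Prime) (n : ℕ) (hn : 0 < n) :
    ∑ k ∈ Finset.Icc 1 (n / p), Nat.totient (p * k)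
      = (p - 1) * ∑ m ∈ Finset.Icc 1 (n / p), Nat.totient m
        + ∑ k ∈ Finset.Icc 1 (n / p / p), Nat.totient (p * k) := by
  rw [sum_congr rfl fun k _ => Nat.totient_prime_mul_eq hp k, sum_add_distrib, ← mul_sum,
    ← sum_filter, sum_Icc_filter_dvd hp.pos]
end

section
/- Let p be an odd prime and let i be an odd integer with 1 ≤ i ≤ 2p−1 and i ≠ p. Then the limit as n → ∞ of (∑_{k=1}^n φ(2p·k − i)) / (2p·n)² equals 2·p / ((p² − 1)·π²). -/
open Filter Finset Real

open ArithmeticFunction in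
theorem totient_eq_sum_range_moebius {m N : ℕ} (hm : 0 < m) (hN : m ≤ N) :
    (Nat.totient m : ℝ) =
      ∑ d ∈ range (N + 1), if d ∣ m then (moebius d : ℝ) / d * m else 0 := by
  have h := (sum_eq_iff_sum_mul_moebius_eq (R := ℝ) (f := fun n => (Nat.totient n : ℝ))
    (g := fun n => (n : ℝ))).1 (fun n _ => by exact_mod_cast Nat.sum_totient n) m hm
  rw [← h, Nat.sum_divisorsAntidiagonal (fun a b => (moebius a : ℝ) * (b : ℝ)), ← sum_filter]
  refine sum_congr_of_eq_on_inter ?_ ?_ ?_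
  · intro d hd hd'
    have hdm := Nat.dvd_of_mem_divisors hd
    have hdN := mem_range.2 (Nat.lt_succ_of_le ((Nat.le_of_dvd hm hdm).trans hN))
    exact absurd (by simp [hdm, mem_range.1 hdN]) hd'
  · intro d hd hd'
    exact absurd (Nat.mem_divisors.2 ⟨(mem_filter.1 hd).2, hm.ne'⟩) hd'
  · intro d hd _
    have hdm := Nat.dvd_of_mem_divisors hd
    have hd0 : (d : ℝ) ≠ 0 := by exact_mod_cast (Nat.pos_of_dvd_of_pos hdm hm).ne'
    rw [Nat.cast_div hdm hd0]
    ring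

theorem abs_card_modEq_sub_le {d : ℕ} (hd : 0 < d) (c n : ℕ) :
    |(∑ k ∈ range n, if k ≡ c [MOD d] then (1 : ℝ) else 0) - n / d| ≤ 1 := by
  rw [← sum_filter, sum_const, nsmul_one, ← Nat.count_eq_card_filter_range,
    Nat.count_modEq_card n hd]
  have hd' : (0 : ℝ) < d := by exact_mod_cast hd
  have h1 : (n : ℝ) / d = (n / d : ℕ) + ((n % d : ℕ) : ℝ) / d := by
    have : ((d * (n / d) + n % d : ℕ) : ℝ) = n := by rw [Nat.div_add_mod]
    push_cast at this ⊢
    field_simp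
    linarith
  have h2 : ((n % d : ℕ) : ℝ) / d ≤ 1 := by
    rw [div_le_one hd']
    exact_mod_cast (Nat.mod_lt n hd).le
  have h3 : 0 ≤ ((n % d : ℕ) : ℝ) / d := by positivity
  rw [h1, abs_le]
  split_ifs <;> constructor <;> push_cast <;> linarith

theorem sum_range_mul_eq_sub_sum (f : ℕ → ℝ) (n : ℕ) :
    ∑ k ∈ range n, (k : ℝ) * f k =
      n * ∑ k ∈ range n, f k - ∑ j ∈ range n, ∑ k ∈ range (j + 1), f k := by
  induction n with
  | zero => simp
  | succ n ih =>
    rw [sum_range_succ, ih, sum_range_succ _ n, sum_range_succ _ n, sum_range_succ _ n]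
    push_cast
    ring

theorem abs_sum_range_mul_le {f : ℕ → ℝ} (hf : ∀ n, |∑ k ∈ range n, f k| ≤ 1) (n : ℕ) :
    |∑ k ∈ range n, (k : ℝ) * f k| ≤ 2 * n := by
  rw [sum_range_mul_eq_sub_sum]
  refine (abs_sub _ _).trans ?_
  rw [abs_mul, Nat.abs_cast]
  have h1 : (n : ℝ) * |∑ k ∈ range n, f k| ≤ n * 1 := by gcongr; exact hf n
  have h2 : |∑ j ∈ range n, ∑ k ∈ range (j + 1), f k| ≤ n := by
    refine (abs_sum_le_sum_abs _ _).trans ?_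
    refine (sum_le_sum fun j _ => hf (j + 1)).trans ?_
    simp
  linarith

theorem abs_sum_Icc_modEq_sub_le {d : ℕ} (hd : 0 < d) (c n : ℕ) :
    |(∑ k ∈ Icc 1 n, if k ≡ c [MOD d] then (k : ℝ) else 0) - (n * (n + 1) / 2) / d| ≤
      2 * (n + 1) := by
  have h := abs_sum_range_mul_le (f := fun k => (if k ≡ c [MOD d] then (1 : ℝ) else 0) - 1 / d)
    (fun m => by
      convert abs_card_modEq_sub_le hd c m using 2
      rw [sum_sub_distrib, sum_const, card_range, nsmul_eq_mul, mul_one_div]) (n + 1)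
  have hid : ∀ m : ℕ, ∑ k ∈ range (m + 1), (k : ℝ) = m * (m + 1) / 2 := fun m => by
    induction m with
    | zero => simp
    | succ m ih => rw [sum_range_succ, ih]; push_cast; ring
  convert h using 2
  · simp_rw [mul_sub, sum_sub_distrib, mul_ite, mul_one, mul_zero, mul_one_div, ← sum_div, hid]
    congr 1
    rw [range_eq_Ico, sum_eq_sum_Ico_succ_bot (Nat.succ_pos n)]
    simp
    rfl
  · push_cast; ring

theorem exists_dvd_mul_sub_iff_modEq {d q : ℕ} (hd : 0 < d) (hdq : d.Coprime q) (i : ℕ) :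
    ∃ c, ∀ k, i ≤ q * k → (d ∣ q * k - i ↔ k ≡ c [MOD d]) := by
  have : NeZero d := ⟨hd.ne'⟩
  let u := ZMod.unitOfCoprime q hdq.symm
  refine ⟨((↑u⁻¹ : ZMod d) * i).val, fun k hk => ?_⟩
  rw [← Nat.modEq_iff_dvd' hk, ← ZMod.natCast_eq_natCast_iff, ← ZMod.natCast_eq_natCast_iff,
    ZMod.natCast_zmod_val, Units.eq_inv_mul_iff_mul_eq, ZMod.coe_unitOfCoprime, eq_comm]
  push_cast
  rfl

theorem tendsto_sum_dvd_progression {d q i : ℕ} (hd : 0 < d) (hdq : d.Coprime q) (hiq : i ≤ q) :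
    Tendsto (fun n : ℕ => (∑ k ∈ Icc 1 n, if d ∣ q * k - i then ((q * k - i : ℕ) : ℝ) else 0) /
      (n : ℝ) ^ 2) atTop (nhds (q / (2 * d))) := by
  obtain ⟨c, hc⟩ := exists_dvd_mul_sub_iff_modEq hd hdq i
  have hd' : (0 : ℝ) < d := by exact_mod_cast hd
  have hlim : Tendsto (fun n : ℕ => (4 * q + i + q / (2 * d)) * (1 / (n : ℝ))) atTop (nhds 0) := by
    simpa using tendsto_one_div_atTop_nhds_zero_nat.const_mul ((4 * q + i + q / (2 * d) : ℝ))
  rw [tendsto_iff_norm_sub_tendsto_zero]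
  refine squeeze_zero' (Eventually.of_forall fun n => norm_nonneg _) ?_ hlim
  filter_upwards [eventually_ge_atTop 1] with n hn
  have hn' : (1 : ℝ) ≤ n := by exact_mod_cast hn
  have hS : (∑ k ∈ Icc 1 n, if d ∣ q * k - i then ((q * k - i : ℕ) : ℝ) else 0) =
      q * (∑ k ∈ Icc 1 n, if k ≡ c [MOD d] then (k : ℝ) else 0) -
        ∑ k ∈ Icc 1 n, if k ≡ c [MOD d] then (i : ℝ) else 0 := by
    rw [mul_sum, ← sum_sub_distrib]
    refine sum_congr rfl fun k hk => ?_
    have hik : i ≤ q * k := hiq.trans (Nat.le_mul_of_pos_right q (mem_Icc.1 hk).1)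
    simp only [hc k hik]
    split_ifs
    · push_cast [Nat.cast_sub hik]; ring
    · simp
  have hA := abs_sum_Icc_modEq_sub_le hd c n
  have hB0 : 0 ≤ ∑ k ∈ Icc 1 n, if k ≡ c [MOD d] then (i : ℝ) else 0 :=
    sum_nonneg fun k _ => by split_ifs <;> positivity
  have hB1 : (∑ k ∈ Icc 1 n, if k ≡ c [MOD d] then (i : ℝ) else 0) ≤ n * i := by
    calc _ ≤ ∑ k ∈ Icc 1 n, (i : ℝ) := sum_le_sum fun k _ => by split_ifs <;> simp
      _ = n * i := by simp
  rw [hS, norm_eq_abs]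
  set A := ∑ k ∈ Icc 1 n, if k ≡ c [MOD d] then (k : ℝ) else 0
  set B := ∑ k ∈ Icc 1 n, if k ≡ c [MOD d] then (i : ℝ) else 0
  have hkey : (q * A - B) / (n : ℝ) ^ 2 - q / (2 * d) =
      (q * (A - n * (n + 1) / 2 / d) - B + q / (2 * d) * n) / (n : ℝ) ^ 2 := by
    field_simp
    ring
  rw [hkey, abs_div, abs_of_pos (by positivity : (0 : ℝ) < (n : ℝ) ^ 2),
    div_le_iff₀ (by positivity)]
  have hR : (4 * q + i + q / (2 * d)) * (1 / (n : ℝ)) * (n : ℝ) ^ 2 =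
      4 * q * n + i * n + q / (2 * d) * n := by
    field_simp
  rw [hR]
  have h1 : |q * (A - n * (n + 1) / 2 / d)| ≤ 4 * q * n := by
    rw [abs_mul, Nat.abs_cast]
    calc (q : ℝ) * |A - n * (n + 1) / 2 / d| ≤ q * (2 * (n + 1)) := by gcongr
      _ ≤ q * (2 * (n + n)) := by gcongr
      _ = 4 * q * n := by ring
  have h3 : 0 ≤ (q : ℝ) / (2 * d) * n := by positivity
  rw [abs_le] at h1 ⊢
  constructor <;> linarith [h1.1, h1.2]

theorem sum_dvd_progression_eq_zero {d q i : ℕ} (hdq : ¬ d.Coprime q) (hiq : i ≤ q)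
    (hi : i.Coprime q) (n : ℕ) :
    (∑ k ∈ Icc 1 n, if d ∣ q * k - i then ((q * k - i : ℕ) : ℝ) else 0) = 0 := by
  refine sum_eq_zero fun k hk => if_neg fun hdvd => hdq ?_
  have hik : i ≤ q * k := hiq.trans (Nat.le_mul_of_pos_right q (mem_Icc.1 hk).1)
  have h1 : d.gcd q ∣ i := by
    rw [← Nat.dvd_sub_iff_right hik ((Nat.gcd_dvd_right d q).mul_right k)]
    exact (Nat.gcd_dvd_left d q).trans hdvd
  exact Nat.dvd_one.1 (hi ▸ Nat.dvd_gcd h1 (Nat.gcd_dvd_right d q))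

theorem sum_dvd_progression_le {q i : ℕ} (hiq : i < q) (d n : ℕ) :
    (∑ k ∈ Icc 1 n, if d ∣ q * k - i then ((q * k - i : ℕ) : ℝ) else 0) ≤
      (q * n : ℝ) ^ 2 / d := by
  have hinj : Set.InjOn (fun k => q * k - i)
      (({k ∈ Icc 1 n | d ∣ q * k - i} : Finset ℕ) : Set ℕ) := by
    intro a ha b hb hab
    have ha' := (mem_Icc.1 (mem_filter.1 ha).1).1
    have hb' := (mem_Icc.1 (mem_filter.1 hb).1).1
    have h1 := Nat.le_mul_of_pos_right q ha'
    have h2 := Nat.le_mul_of_pos_right q hb'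
    exact Nat.eq_of_mul_eq_mul_left (by lia : 0 < q) (by simp only at hab; lia)
  have hcard : #{k ∈ Icc 1 n | d ∣ q * k - i} ≤ q * n / d := by
    rw [← card_image_of_injOn hinj, ← Nat.Ioc_filter_dvd_card_eq_div]
    refine card_le_card fun m hm => ?_
    obtain ⟨k, hk, rfl⟩ := mem_image.1 hm
    obtain ⟨hk1, hk2⟩ := mem_filter.1 hk
    have h1 := Nat.le_mul_of_pos_right q (mem_Icc.1 hk1).1
    have h2 := Nat.mul_le_mul_left q (mem_Icc.1 hk1).2
    exact mem_filter.2 ⟨mem_Ioc.2 ⟨by lia, by lia⟩, hk2⟩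
  rw [← sum_filter]
  calc _ ≤ ∑ k ∈ Icc 1 n with d ∣ q * k - i, (q * n : ℝ) := by
        refine sum_le_sum fun k hk => ?_
        have h2 := Nat.mul_le_mul_left q (mem_Icc.1 (mem_filter.1 hk).1).2
        exact_mod_cast (Nat.sub_le _ _).trans h2
    _ = (#{k ∈ Icc 1 n | d ∣ q * k - i} : ℝ) * (q * n) := by rw [sum_const, nsmul_eq_mul]
    _ ≤ ((q * n / d : ℕ) : ℝ) * (q * n) := by gcongr
    _ ≤ ((q * n : ℕ) / d : ℝ) * (q * n) := by gcongr; exact Nat.cast_div_le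
    _ = (q * n : ℝ) ^ 2 / d := by push_cast; ring

open ArithmeticFunction in
theorem tendsto_sum_totient_progression {q i : ℕ} (hiq : i < q) (hi : i.Coprime q) :
    Tendsto (fun n : ℕ => (∑ k ∈ Icc 1 n, (Nat.totient (q * k - i) : ℝ)) / (q * n : ℝ) ^ 2) atTop
      (nhds (∑' d : ℕ, if d.Coprime q then (moebius d : ℝ) / d ^ 2 / (2 * q) else 0)) := by
  have hq : (0 : ℝ) < q := by exact_mod_cast (Nat.zero_le i).trans_lt hiq
  have hexp : ∀ n : ℕ, (∑ k ∈ Icc 1 n, (Nat.totient (q * k - i) : ℝ)) / (q * n : ℝ) ^ 2 =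
      ∑' d : ℕ, (moebius d : ℝ) / d *
        ((∑ k ∈ Icc 1 n, if d ∣ q * k - i then ((q * k - i : ℕ) : ℝ) else 0) /
          (q * n : ℝ) ^ 2) := by
    intro n
    have hpos : ∀ k ∈ Icc 1 n, 0 < q * k - i ∧ q * k - i ≤ q * n := fun k hk => by
      have h1 := Nat.le_mul_of_pos_right q (mem_Icc.1 hk).1
      have h2 := Nat.mul_le_mul_left q (mem_Icc.1 hk).2
      lia
    rw [tsum_eq_sum (s := range (q * n + 1))]
    · rw [sum_congr rfl fun k hk => totient_eq_sum_range_moebius (hpos k hk).1 (hpos k hk).2,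
        sum_comm, sum_div]
      refine sum_congr rfl fun d _ => ?_
      rw [← mul_div_assoc, mul_sum]
      simp only [mul_ite, mul_zero]
    · intro d hd
      rw [sum_eq_zero, zero_div, mul_zero]
      intro k hk
      refine if_neg fun hdvd => hd (mem_range.2 ?_)
      have := Nat.le_of_dvd (hpos k hk).1 hdvd
      have := (hpos k hk).2
      lia
  simp_rw [hexp]
  refine tendsto_tsum_of_dominated_convergence (bound := fun d : ℕ => 1 / (d : ℝ) ^ 2)
    (summable_one_div_nat_pow.2 one_lt_two) (fun d => ?_) (Eventually.of_forall fun n d => ?_)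
  · rcases Nat.eq_zero_or_pos d with rfl | hd
    · simp
    split_ifs with hdq
    · have h := ((tendsto_sum_dvd_progression hd hdq hiq.le).div_const ((q : ℝ) ^ 2)).const_mul
        ((moebius d : ℝ) / d)
      have hd' : (0 : ℝ) < d := by exact_mod_cast hd
      convert h using 2 with n
      · rw [div_div]; ring
      · field_simp
    · simp only [sum_dvd_progression_eq_zero hdq hiq.le hi, zero_div, mul_zero, tendsto_const_nhds]
  · have hμ : |(moebius d : ℝ)| ≤ 1 := by exact_mod_cast abs_moebius_le_one (n := d)
    have hS0 : 0 ≤ ∑ k ∈ Icc 1 n, if d ∣ q * k - i then ((q * k - i : ℕ) : ℝ) else 0 :=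
      sum_nonneg fun k _ => by split_ifs <;> positivity
    rw [norm_eq_abs, abs_mul, abs_div, Nat.abs_cast, abs_of_nonneg (div_nonneg hS0 (sq_nonneg _))]
    calc _ ≤ 1 / (d : ℝ) * ((q * n : ℝ) ^ 2 / d / (q * n : ℝ) ^ 2) := by
          gcongr
          exact sum_dvd_progression_le hiq d n
      _ = 1 / (d : ℝ) ^ 2 * ((q * n : ℝ) ^ 2 / (q * n : ℝ) ^ 2) := by ring
      _ ≤ 1 / (d : ℝ) ^ 2 * 1 := by gcongr; exact div_self_le_one _
      _ = _ := mul_one _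

open ArithmeticFunction in
theorem tsum_coprime_moebius_div_sq {q : ℕ} [NeZero q] :
    (∑' d : ℕ, if d.Coprime q then (moebius d : ℝ) / d ^ 2 else 0) =
      ((∏ r ∈ q.primeFactors, (1 - ((r : ℝ) ^ 2)⁻¹)) * (π ^ 2 / 6))⁻¹ := by
  have h2 : 1 < (2 : ℂ).re := by norm_num
  have hmul := DirichletCharacter.LSeries.mul_mu_eq_one (1 : DirichletCharacter ℂ q) h2
  have hL := DirichletCharacter.LFunctionTrivChar_eq_mul_riemannZeta (N := q) (s := 2) (by norm_num)
  rw [DirichletCharacter.LFunctionTrivChar] at hL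
  rw [← DirichletCharacter.LFunction_eq_LSeries _ h2, hL, riemannZeta_two] at hmul
  apply eq_inv_of_mul_eq_one_right
  rw [← Complex.ofReal_inj, Complex.ofReal_mul, Complex.ofReal_tsum, Complex.ofReal_one, ← hmul]
  congr 1
  · push_cast
    simp only [Complex.cpow_neg, Complex.cpow_ofNat]
  · refine tsum_congr fun d => ?_
    rcases Nat.eq_zero_or_pos d with rfl | hd
    · simp
    rw [LSeries.term_of_ne_zero hd.ne']
    rw [Pi.mul_apply]
    split_ifs with hdq
    · rw [MulChar.one_apply ((ZMod.isUnit_iff_coprime d q).2 hdq)]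
      simp
    · rw [MulChar.map_nonunit _ (mt (ZMod.isUnit_iff_coprime d q).1 hdq)]
      simp

theorem phi_sum_odd_residue_class_mod_2p_limit (p : ℕ) (hp : p.Prime) (hodd : Odd p)
    (i : ℕ) (hi : Odd i) (hi1 : 1 ≤ i) (hi2 : i ≤ 2 * p - 1) (hip : i ≠ p) :
    Tendsto (fun n : ℕ =>
        (∑ k ∈ Finset.Icc 1 n, (Nat.totient (2 * p * k - i) : ℝ)) /
          (2 * (p : ℝ) * n) ^ 2)
      atTop (nhds (2 * (p : ℝ) / (((p : ℝ) ^ 2 - 1) * π ^ 2))) := by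
  have hp2 := hp.two_le
  have : NeZero (2 * p) := ⟨by lia⟩
  have hpi : ¬ p ∣ i := by
    rintro ⟨m, rfl⟩
    have hm0 : m ≠ 0 := by rintro rfl; simp at hi1
    have hm1 : m ≠ 1 := by rintro rfl; simp at hip
    have : p * 2 ≤ p * m := Nat.mul_le_mul_left p (by lia)
    lia
  have hcop : i.Coprime (2 * p) :=
    (Nat.coprime_two_right.2 hi).mul_right ((hp.coprime_iff_not_dvd.2 hpi).symm)
  have hne : 2 ≠ p := by rintro rfl; exact absurd hodd (by decide)
  have h := tendsto_sum_totient_progression (by lia : i < 2 * p) hcop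
  have hval : (∑' d : ℕ, if d.Coprime (2 * p) then
      (ArithmeticFunction.moebius d : ℝ) / d ^ 2 / (2 * (2 * p : ℕ)) else 0) =
      2 * (p : ℝ) / (((p : ℝ) ^ 2 - 1) * π ^ 2) := by
    have hdiv : ∀ d : ℕ, (if d.Coprime (2 * p) then
        (ArithmeticFunction.moebius d : ℝ) / d ^ 2 / (2 * (2 * p : ℕ)) else 0) =
        (if d.Coprime (2 * p) then (ArithmeticFunction.moebius d : ℝ) / d ^ 2 else 0) /
          (2 * (2 * p : ℕ)) := fun d => by rw [ite_div, zero_div]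
    rw [tsum_congr hdiv, tsum_div_const, tsum_coprime_moebius_div_sq,
      Nat.primeFactors_mul two_ne_zero hp.ne_zero, Nat.prime_two.primeFactors, hp.primeFactors,
      ← insert_eq, prod_pair hne]
    have hp' : (2 : ℝ) ≤ p := by exact_mod_cast hp2
    have hp1 : (p : ℝ) ^ 2 - 1 ≠ 0 := by nlinarith
    push_cast
    field_simp
    norm_num
  rw [hval] at h
  simpa only [Nat.cast_mul, Nat.cast_ofNat] using h
end

section
/- Let p be an odd prime. Then the limit as n → ∞ of (∑_{k=1}^n φ(2p·k − p)) / (2p·n)² equals 2 / ((p+1)·π²). -/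
open Filter Finset Real

open scoped ArithmeticFunction.Moebius

/-- The Möbius function restricted to the integers coprime to `N`. -/
noncomputable def coprimeMoebius (N d : ℕ) : ℝ :=
  if d.Coprime N then (μ d : ℝ) else 0

lemma abs_coprimeMoebius_le_one (N d : ℕ) : |coprimeMoebius N d| ≤ 1 := by
  unfold coprimeMoebius
  split_ifs
  · exact_mod_cast ArithmeticFunction.abs_moebius_le_one
  · simp

lemma totient_eq_sum_moebius_mul_div {m : ℕ} (hm : 0 < m) :
    (m.totient : ℝ) = ∑ d ∈ m.divisors, (μ d : ℝ) * ((m : ℝ) / d) := by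
  have h := (ArithmeticFunction.sum_eq_iff_sum_mul_moebius_eq (R := ℝ)
    (f := fun n ↦ (n.totient : ℝ)) (g := fun n ↦ (n : ℝ))).mp
    (fun n _ ↦ by exact_mod_cast Nat.sum_totient n) m hm
  rw [← h, Nat.sum_divisorsAntidiagonal (fun a b ↦ (μ a : ℝ) * (b : ℝ))]
  refine Finset.sum_congr rfl fun d hd ↦ ?_
  have hd0 : (d : ℝ) ≠ 0 := by exact_mod_cast (Nat.pos_of_mem_divisors hd).ne'
  rw [Nat.cast_div (Nat.dvd_of_mem_divisors hd) hd0]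

lemma totient_prime_mul_eq_sum {p : ℕ} (hp : p.Prime) {m : ℕ} (hm : 0 < m) :
    ((p * m).totient : ℝ) =
      ((p : ℝ) - 1) * ∑ d ∈ m.divisors, coprimeMoebius p d * ((m : ℝ) / d) := by
  obtain ⟨a, l, hl, rfl⟩ := Nat.exists_eq_pow_mul_and_not_dvd hm.ne' p hp.ne_one
  have hl0 : 0 < l := Nat.pos_of_mul_pos_left hm
  have hcop : Nat.Coprime l p := (Nat.Prime.coprime_iff_not_dvd hp).mpr hl |>.symm
  have hfilter : (p ^ a * l).divisors.filter (fun d ↦ d.Coprime p) = l.divisors := by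
    ext d
    simp only [Finset.mem_filter, Nat.mem_divisors]
    constructor
    · rintro ⟨⟨h, -⟩, hd⟩
      exact ⟨(Nat.Coprime.pow_right a hd).dvd_of_dvd_mul_left h, hl0.ne'⟩
    · rintro ⟨h, -⟩
      exact ⟨⟨h.mul_left _, hm.ne'⟩, hcop.coprime_dvd_left h⟩
  have hsum : ∑ d ∈ (p ^ a * l).divisors, coprimeMoebius p d * (((p ^ a * l : ℕ) : ℝ) / d) =
      (p : ℝ) ^ a * (l.totient : ℝ) := by
    simp_rw [coprimeMoebius, ite_mul, zero_mul]
    rw [← Finset.sum_filter, hfilter, totient_eq_sum_moebius_mul_div hl0, Finset.mul_sum]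
    refine Finset.sum_congr rfl fun d _ ↦ ?_
    push_cast
    ring
  rw [hsum, ← mul_assoc, ← pow_succ', Nat.totient_mul (hcop.symm.pow_left _),
    Nat.totient_prime_pow_succ hp]
  push_cast [Nat.cast_sub hp.one_le]
  ring

lemma totient_prime_mul_odd_eq_sum {p : ℕ} (hp : p.Prime) {m : ℕ} (hm : Odd m) :
    ((p * m).totient : ℝ) =
      ((p : ℝ) - 1) * ∑ d ∈ m.divisors, coprimeMoebius (2 * p) d * ((m : ℝ) / d) := by
  rw [totient_prime_mul_eq_sum hp hm.pos]
  congr 1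
  refine Finset.sum_congr rfl fun d hd ↦ ?_
  have hd_odd : Odd d := hm.of_dvd_nat (Nat.dvd_of_mem_divisors hd)
  simp [coprimeMoebius, Nat.coprime_mul_iff_right, hd_odd]

/-- The sum of the cofactors of `d` in the odd numbers below `2 * n` that `d` divides. -/
noncomputable def oddCofactorSum (n d : ℕ) : ℝ :=
  ∑ k ∈ Finset.Icc 1 n, if d ∣ 2 * k - 1 then ((2 * k - 1 : ℕ) : ℝ) / d else 0

lemma oddCofactorSum_eq_sq (n e : ℕ) :
    oddCofactorSum n (2 * e + 1) = (((n + e) / (2 * e + 1) : ℕ) : ℝ) ^ 2 := by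
  induction n with
  | zero => simp [oddCofactorSum, Nat.div_eq_of_lt (show e < 2 * e + 1 by omega)]
  | succ n ih =>
    unfold oddCofactorSum at ih ⊢
    rw [Finset.sum_Icc_succ_top (by omega), ih, show n + 1 + e = n + e + 1 by ring, Nat.succ_div]
    have hiff : 2 * e + 1 ∣ 2 * (n + 1) - 1 ↔ 2 * e + 1 ∣ n + e + 1 := by
      rw [← Nat.dvd_add_left (dvd_refl (2 * e + 1)),
        show 2 * (n + 1) - 1 + (2 * e + 1) = 2 * (n + e + 1) by omega]
      exact Nat.Coprime.dvd_mul_left (by simp)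
    by_cases h : 2 * e + 1 ∣ n + e + 1
    · rw [if_pos h, if_pos (hiff.mpr h)]
      have hq : (n + e) / (2 * e + 1) + 1 = (n + e + 1) / (2 * e + 1) := by
        rw [Nat.succ_div, if_pos h]
      have hmul : (2 * e + 1) * ((n + e) / (2 * e + 1) + 1) = n + e + 1 := by
        rw [hq, Nat.mul_div_cancel' h]
      generalize (n + e) / (2 * e + 1) = q at hmul ⊢
      have hmul' : (2 * (e : ℝ) + 1) * (q + 1) = n + e + 1 := by exact_mod_cast hmul
      rw [show 2 * (n + 1) - 1 = 2 * n + 1 by omega]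
      push_cast
      have : (2 * (e : ℝ) + 1) ≠ 0 := by positivity
      field_simp
      linear_combination (-2) * hmul'
    · rw [if_neg h, if_neg (mt hiff.mp h)]
      simp

lemma oddCofactorSum_eq_zero_of_lt {n d : ℕ} (h : 2 * n < d) : oddCofactorSum n d = 0 := by
  refine Finset.sum_eq_zero fun k hk ↦ if_neg fun hd ↦ ?_
  rw [Finset.mem_Icc] at hk
  have := Nat.le_of_dvd (by omega) hd
  omega

lemma oddCofactorSum_div_sq_le (n e : ℕ) :
    oddCofactorSum n (2 * e + 1) / (n : ℝ) ^ 2 ≤ 4 / ((2 * e + 1 : ℕ) : ℝ) ^ 2 := by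
  rw [oddCofactorSum_eq_sq]
  rcases Nat.eq_zero_or_pos n with rfl | hn
  · simp only [Nat.cast_zero, ne_eq, OfNat.ofNat_ne_zero, not_false_eq_true, zero_pow, div_zero]
    positivity
  have hle : (((n + e) / (2 * e + 1) : ℕ) : ℝ) ≤ 2 * n / ((2 * e + 1 : ℕ) : ℝ) := by
    rcases le_or_gt n e with h | h
    · rw [Nat.div_eq_of_lt (by omega), Nat.cast_zero]
      positivity
    · refine Nat.cast_div_le.trans ?_
      gcongr
      exact_mod_cast (show n + e ≤ 2 * n by omega)
  have hn' : (0 : ℝ) < n := by exact_mod_cast hn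
  calc _ ≤ (2 * n / ((2 * e + 1 : ℕ) : ℝ)) ^ 2 / (n : ℝ) ^ 2 := by gcongr
    _ = _ := by field_simp; norm_num

lemma tendsto_oddCofactorSum_div_sq (e : ℕ) :
    Tendsto (fun n : ℕ ↦ oddCofactorSum n (2 * e + 1) / (n : ℝ) ^ 2) atTop
      (nhds (1 / ((2 * e + 1 : ℕ) : ℝ) ^ 2)) := by
  have hd : (0 : ℝ) < ((2 * e + 1 : ℕ) : ℝ) := by positivity
  have key : Tendsto (fun n : ℕ ↦ (((n + e) / (2 * e + 1) : ℕ) : ℝ) / n) atTop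
      (nhds (1 / ((2 * e + 1 : ℕ) : ℝ))) := by
    have hinv : Tendsto (fun n : ℕ ↦ 1 / (n : ℝ)) atTop (nhds 0) :=
      tendsto_one_div_atTop_nhds_zero_nat
    have hlo : Tendsto (fun n : ℕ ↦ 1 / ((2 * e + 1 : ℕ) : ℝ) - 1 / (n : ℝ)) atTop
        (nhds (1 / ((2 * e + 1 : ℕ) : ℝ))) := by
      simpa using tendsto_const_nhds.sub hinv
    have hhi : Tendsto (fun n : ℕ ↦ 1 / ((2 * e + 1 : ℕ) : ℝ) + 1 / (n : ℝ)) atTop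
        (nhds (1 / ((2 * e + 1 : ℕ) : ℝ))) := by
      simpa using tendsto_const_nhds.add hinv
    refine tendsto_of_tendsto_of_tendsto_of_le_of_le' hlo hhi ?_ ?_
    all_goals
      filter_upwards [eventually_gt_atTop 0] with n hn
      have hn' : (0 : ℝ) < n := by exact_mod_cast hn
      have h1 := Nat.div_add_mod (n + e) (2 * e + 1)
      have h2 := Nat.mod_lt (n + e) (show 2 * e + 1 > 0 by omega)
      generalize (n + e) / (2 * e + 1) = q at *
    · have h3 : n ≤ (2 * e + 1) * (q + 1) := by rw [mul_add]; omega
      have h3' : (n : ℝ) ≤ ((2 * e + 1 : ℕ) : ℝ) * (q + 1) := by exact_mod_cast h3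
      rw [div_sub_div _ _ hd.ne' hn'.ne', div_le_div_iff₀ (by positivity) hn']
      nlinarith
    · have h3 : (2 * e + 1) * q ≤ n + (2 * e + 1) := by omega
      have h3' : ((2 * e + 1 : ℕ) : ℝ) * q ≤ n + ((2 * e + 1 : ℕ) : ℝ) := by exact_mod_cast h3
      rw [div_add_div _ _ hd.ne' hn'.ne', div_le_div_iff₀ hn' (by positivity)]
      nlinarith
  simp_rw [oddCofactorSum_eq_sq, ← div_pow]
  simpa [div_pow] using key.pow 2

lemma coprimeMoebius_eq_zero_of_even {N d : ℕ} (hN : Even N) (hd : Even d) :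
    coprimeMoebius N d = 0 :=
  if_neg (Nat.not_coprime_of_dvd_of_dvd one_lt_two hd.two_dvd hN.two_dvd)

lemma tendsto_tsum_coprimeMoebius_mul_oddCofactorSum {N : ℕ} (hN : Even N) :
    Tendsto (fun n : ℕ ↦ ∑' d, coprimeMoebius N d * (oddCofactorSum n d / (n : ℝ) ^ 2)) atTop
      (nhds (∑' d : ℕ, coprimeMoebius N d * (1 / (d : ℝ) ^ 2))) := by
  refine tendsto_tsum_of_dominated_convergence (bound := fun d : ℕ ↦ 4 / (d : ℝ) ^ 2) ?_ ?_ ?_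
  · simpa [div_eq_mul_inv] using
      (Real.summable_nat_pow_inv.mpr one_lt_two).mul_left (4 : ℝ)
  · intro d
    rcases Nat.even_or_odd d with hd | ⟨e, rfl⟩
    · simp [coprimeMoebius_eq_zero_of_even hN hd]
    · exact (tendsto_oddCofactorSum_div_sq e).const_mul _
  · refine Eventually.of_forall fun n d ↦ ?_
    rcases Nat.even_or_odd d with hd | ⟨e, rfl⟩
    · rw [coprimeMoebius_eq_zero_of_even hN hd, zero_mul, norm_zero]
      positivity
    · have hnonneg : 0 ≤ oddCofactorSum n (2 * e + 1) / (n : ℝ) ^ 2 := by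
        rw [oddCofactorSum_eq_sq]
        positivity
      rw [norm_mul, Real.norm_eq_abs, Real.norm_of_nonneg hnonneg]
      exact (mul_le_of_le_one_left hnonneg (abs_coprimeMoebius_le_one _ _)).trans
        (oddCofactorSum_div_sq_le n e)

lemma tsum_coprimeMoebius_div_sq (N : ℕ) [NeZero N] :
    (∑' d : ℕ, coprimeMoebius N d * (1 / (d : ℝ) ^ 2)) *
      ((∏ q ∈ N.primeFactors, (1 - 1 / (q : ℝ) ^ 2)) * (π ^ 2 / 6)) = 1 := by
  have hs : 1 < (2 : ℂ).re := by simp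
  have h := DirichletCharacter.LSeries.mul_mu_eq_one (1 : DirichletCharacter ℂ N) hs
  rw [← DirichletCharacter.LFunction_eq_LSeries _ hs,
    show DirichletCharacter.LFunction (1 : DirichletCharacter ℂ N) 2 = _ from
      DirichletCharacter.LFunctionTrivChar_eq_mul_riemannZeta (by norm_num),
    riemannZeta_two, mul_comm] at h
  have hterm : LSeries ((fun n : ℕ ↦ (1 : DirichletCharacter ℂ N) n) * fun n ↦ ((μ n : ℤ) : ℂ)) 2 =
      ((∑' d : ℕ, coprimeMoebius N d * (1 / (d : ℝ) ^ 2) : ℝ) : ℂ) := by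
    rw [LSeries, Complex.ofReal_tsum]
    refine tsum_congr fun d ↦ ?_
    rcases eq_or_ne d 0 with rfl | hd
    · simp
    rw [LSeries.term_of_ne_zero hd, coprimeMoebius, Pi.mul_apply]
    by_cases hc : d.Coprime N
    · rw [if_pos hc, MulChar.one_apply ((ZMod.isUnit_iff_coprime d N).mpr hc)]
      push_cast
      rw [one_mul, mul_one_div]
      norm_cast
    · rw [if_neg hc, MulChar.map_nonunit _ (mt (ZMod.isUnit_iff_coprime d N).mp hc)]
      simp
  rw [hterm] at h
  have hcpow (q : ℕ) : (q : ℂ) ^ (-2 : ℂ) = ((1 / (q : ℝ) ^ 2 : ℝ) : ℂ) := by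
    rw [Complex.cpow_neg]
    push_cast
    rw [one_div]
    norm_cast
  simp_rw [hcpow] at h
  exact_mod_cast h

lemma sum_totient_odd_multiples_eq_tsum {p : ℕ} (hp : p.Prime) (n : ℕ) :
    ∑ k ∈ Finset.Icc 1 n, (Nat.totient (2 * p * k - p) : ℝ) =
      ((p : ℝ) - 1) * ∑' d, coprimeMoebius (2 * p) d * oddCofactorSum n d := by
  rw [tsum_eq_sum (s := Finset.range (2 * n + 1)) fun d hd ↦ by
    rw [oddCofactorSum_eq_zero_of_lt (by simpa using hd), mul_zero]]
  simp_rw [oddCofactorSum, Finset.mul_sum]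
  rw [Finset.sum_comm]
  refine Finset.sum_congr rfl fun k hk ↦ ?_
  rw [Finset.mem_Icc] at hk
  have hodd : Odd (2 * k - 1) := ⟨k - 1, by omega⟩
  rw [show 2 * p * k - p = p * (2 * k - 1) by rw [Nat.mul_sub, mul_one]; congr 1; ring,
    totient_prime_mul_odd_eq_sum hp hodd, Finset.mul_sum]
  have hdiv : (2 * k - 1).divisors = (Finset.range (2 * n + 1)).filter (· ∣ 2 * k - 1) := by
    ext d
    simp only [Nat.mem_divisors, Finset.mem_filter, Finset.mem_range]
    constructor
    · rintro ⟨h, -⟩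
      have := Nat.le_of_dvd (by omega) h
      exact ⟨by omega, h⟩
    · rintro ⟨-, h⟩
      exact ⟨h, by omega⟩
  rw [hdiv, Finset.sum_filter]
  simp_rw [mul_ite, mul_zero]

theorem phi_sum_odd_multiples_of_p_limit (p : ℕ) (hp : p.Prime) (hodd : Odd p) :
    Tendsto (fun n : ℕ =>
        (∑ k ∈ Finset.Icc 1 n, (Nat.totient (2 * p * k - p) : ℝ)) /
          (2 * (p : ℝ) * n) ^ 2)
      atTop (nhds (2 / (((p : ℝ) + 1) * π ^ 2))) := by
  have hp1 : (1 : ℝ) < p := by exact_mod_cast hp.one_lt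
  have hp2 : p ≠ 2 := by
    rintro rfl
    exact absurd hodd (by decide)
  have : NeZero (2 * p) := ⟨mul_ne_zero two_ne_zero hp.ne_zero⟩
  have hlim := (tendsto_tsum_coprimeMoebius_mul_oddCofactorSum (even_two_mul p)).const_mul
    (((p : ℝ) - 1) / (2 * p) ^ 2)
  have hval := tsum_coprimeMoebius_div_sq (2 * p)
  rw [Nat.primeFactors_mul two_ne_zero hp.ne_zero, Nat.prime_two.primeFactors, hp.primeFactors,
    Finset.prod_union (by simpa using hp2.symm), Finset.prod_singleton,
    Finset.prod_singleton] at hval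
  convert hlim using 2 with n
  · rw [sum_totient_odd_multiples_eq_tsum hp]
    simp_rw [← mul_div_assoc, tsum_div_const]
    ring
  · generalize (∑' d : ℕ, coprimeMoebius (2 * p) d * (1 / (d : ℝ) ^ 2)) = S at hval ⊢
    have hpi := Real.pi_pos
    have hp0 : (p : ℝ) ≠ 0 := by positivity
    push_cast at hval
    field_simp at hval ⊢
    nlinarith
end

section
/- The limit as n → ∞ of (∑_{k=1}^n φ(4k − 2)) / (4n)² equals 1 / (2π²). -/
open Filter Finset Real

lemma sum_odd_Ioc (N : ℕ) :
    ∑ e ∈ Ioc 0 N, (if Odd e then (e : ℝ) else 0) = (((N + 1) / 2 : ℕ) : ℝ) ^ 2 := by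
  induction N with
  | zero => simp
  | succ N ih =>
    rw [← Finset.insert_Ioc_right_eq_Ioc_add_one (Nat.zero_le N), sum_insert (by simp), ih]
    rcases Nat.even_or_odd' N with ⟨m, rfl | rfl⟩
    · rw [if_pos (by simp), show (2 * m + 1 + 1) / 2 = m + 1 by omega,
        show (2 * m + 1) / 2 = m by omega]
      push_cast; ring
    · rw [if_neg (by simp [parity_simps]), show (2 * m + 1 + 1 + 1) / 2 = m + 1 by omega,
        show (2 * m + 1 + 1) / 2 = m + 1 by omega]
      simp

lemma sum_totient_four_mul_sub_two (n : ℕ) :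
    ∑ k ∈ Icc 1 n, (Nat.totient (4 * k - 2) : ℝ) =
      ∑ m ∈ Ioc 0 (2 * n), if Odd m then (Nat.totient m : ℝ) else 0 := by
  induction n with
  | zero => simp
  | succ n ih =>
    rw [sum_Icc_succ_top (by omega), ih, show 2 * (n + 1) = 2 * n + 1 + 1 by ring,
      ← Finset.insert_Ioc_right_eq_Ioc_add_one (Nat.zero_le _), sum_insert (by simp),
      ← Finset.insert_Ioc_right_eq_Ioc_add_one (Nat.zero_le _), sum_insert (by simp),
      if_neg (by simp [parity_simps]), if_pos (by simp),
      show 4 * (n + 1) - 2 = 2 * (2 * n + 1) by omega,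
      Nat.totient_mul (by simp)]
    simp [add_comm]

/-- The sum of `φ` over odd `m ≤ N`, by Möbius inversion. -/
lemma sum_totient_odd (N : ℕ) :
    (∑ m ∈ Ioc 0 N, if Odd m then (Nat.totient m : ℝ) else 0) =
      ∑ d ∈ Ioc 0 N, (if Odd d then (ArithmeticFunction.moebius d : ℝ) else 0) *
        (((N / d + 1) / 2 : ℕ) : ℝ) ^ 2 := by
  let f : ArithmeticFunction ℝ :=
    ⟨fun d ↦ if Odd d then (ArithmeticFunction.moebius d : ℝ) else 0, by simp⟩
  let g : ArithmeticFunction ℝ := ⟨fun e ↦ if Odd e then (e : ℝ) else 0, by simp⟩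
  have key := ArithmeticFunction.sum_Ioc_mul_eq_sum_sum f g N
  have hinv := (ArithmeticFunction.sum_eq_iff_sum_mul_moebius_eq (R := ℝ)
    (f := fun n ↦ (Nat.totient n : ℝ)) (g := fun n ↦ (n : ℝ))).1
    fun n _ ↦ by exact_mod_cast Nat.sum_totient n
  have hl : ∀ m ∈ Ioc 0 N, (f * g) m = if Odd m then (Nat.totient m : ℝ) else 0 := by
    intro m hm
    rw [ArithmeticFunction.mul_apply]
    split_ifs with hodd
    · rw [← hinv m (mem_Ioc.1 hm).1]
      refine sum_congr rfl fun x hx ↦ ?_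
      rw [← (Nat.mem_divisorsAntidiagonal.1 hx).1, Nat.odd_mul] at hodd
      simp [f, g, hodd.1, hodd.2]
    · refine sum_eq_zero fun x hx ↦ ?_
      rw [← (Nat.mem_divisorsAntidiagonal.1 hx).1, Nat.odd_mul, not_and_or] at hodd
      rcases hodd with h | h <;> simp [f, g, h]
  rw [← sum_congr rfl hl, key]
  refine sum_congr rfl fun d _ ↦ ?_
  rw [← sum_odd_Ioc]
  rfl

lemma abs_moebius_div_sq_le (d : ℕ) :
    ‖(ArithmeticFunction.moebius d : ℝ) / (d : ℝ) ^ 2‖ ≤ 1 / (d : ℝ) ^ 2 := by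
  rw [norm_div, norm_pow, Real.norm_natCast, Real.norm_eq_abs]
  gcongr
  exact_mod_cast ArithmeticFunction.abs_moebius_le_one

lemma tsum_moebius_div_sq :
    ∑' d : ℕ, (ArithmeticFunction.moebius d : ℝ) / (d : ℝ) ^ 2 = 6 / π ^ 2 := by
  have h := ArithmeticFunction.LSeries_zeta_mul_Lseries_moebius (s := 2) (by norm_num)
  rw [ArithmeticFunction.LSeries_zeta_eq_riemannZeta (by norm_num), riemannZeta_two] at h
  have h2 : LSeries (fun n ↦ ((ArithmeticFunction.moebius n : ℤ) : ℂ)) 2 =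
      ((∑' d : ℕ, (ArithmeticFunction.moebius d : ℝ) / (d : ℝ) ^ 2 : ℝ) : ℂ) := by
    rw [LSeries, Complex.ofReal_tsum]
    refine tsum_congr fun d ↦ ?_
    rcases eq_or_ne d 0 with rfl | hd
    · simp
    · rw [LSeries.term_of_ne_zero hd]
      norm_cast
  rw [h2] at h
  have h3 : π ^ 2 / 6 * ∑' d : ℕ, (ArithmeticFunction.moebius d : ℝ) / (d : ℝ) ^ 2 = 1 := by
    exact_mod_cast h
  have := Real.pi_pos
  rw [eq_div_iff (by positivity)]
  linarith

lemma moebius_two_mul (d : ℕ) : ArithmeticFunction.moebius (2 * d) =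
    if Odd d then -ArithmeticFunction.moebius d else 0 := by
  split_ifs with hd
  · rw [ArithmeticFunction.isMultiplicative_moebius.map_mul_of_coprime
      (Nat.coprime_two_left.2 hd), ArithmeticFunction.moebius_apply_prime Nat.prime_two]
    ring
  · rw [ArithmeticFunction.moebius_eq_zero_of_not_squarefree]
    intro h
    obtain ⟨m, rfl⟩ := Nat.not_odd_iff_even.1 hd
    simpa using h 2 ⟨m, by ring⟩

lemma tsum_odd_moebius_div_sq :
    ∑' d : ℕ, (if Odd d then (ArithmeticFunction.moebius d : ℝ) else 0) / (d : ℝ) ^ 2 =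
      8 / π ^ 2 := by
  have hS : Summable fun d : ℕ ↦ 1 / (d : ℝ) ^ 2 := hasSum_zeta_two.summable
  set G : ℕ → ℝ := fun d ↦ (ArithmeticFunction.moebius d : ℝ) / (d : ℝ) ^ 2 with hG
  set F : ℕ → ℝ :=
    fun d ↦ (if Odd d then (ArithmeticFunction.moebius d : ℝ) else 0) / (d : ℝ) ^ 2 with hF
  have hGs : Summable G := hS.of_norm_bounded abs_moebius_div_sq_le
  have hFs : Summable F := by
    refine hGs.norm.of_norm_bounded fun d ↦ ?_
    by_cases hd : Odd d <;> simp [hF, hG, hd]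
    positivity
  have hinj : Function.Injective fun k : ℕ ↦ 2 * k := fun a b h ↦ by simpa using h
  have hinj' : Function.Injective fun k : ℕ ↦ 2 * k + 1 := fun a b h ↦ by simpa using h
  have h1 := tsum_even_add_odd (hGs.comp_injective hinj) (hGs.comp_injective hinj')
  have h2 := tsum_even_add_odd (hFs.comp_injective hinj) (hFs.comp_injective hinj')
  have e1 : ∀ k, G (2 * k) = -(1 / 4) * F k := by
    intro k
    simp only [hG, hF, moebius_two_mul]
    split_ifs <;> push_cast <;> ring
  have e2 : ∀ k, F (2 * k) = 0 := fun k ↦ by simp [hF]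
  have e3 : ∀ k, F (2 * k + 1) = G (2 * k + 1) := fun k ↦ by simp [hF, hG]
  simp only [e2, e3, tsum_zero, zero_add] at h2
  simp only [e1, tsum_mul_left, h2] at h1
  rw [tsum_moebius_div_sq] at h1
  rw [show 8 / π ^ 2 = 4 / 3 * (6 / π ^ 2) by ring, ← h1]
  ring

lemma abs_floor_div_sub_le (n d : ℕ) (hn : 0 < n) (hd : 0 < d) :
    |(((2 * n / d + 1) / 2 : ℕ) : ℝ) / n - 1 / d| ≤ 1 / n := by
  set q := 2 * n / d
  set r := (q + 1) / 2
  have h1 : 2 * r ≤ q + 1 := by omega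
  have h2 : q ≤ 2 * r := by omega
  have h3 : q * d ≤ 2 * n := Nat.div_mul_le_self _ _
  have h4 : 2 * n < (q + 1) * d := (Nat.lt_mul_div_succ _ hd).trans_eq (mul_comm _ _)
  have hn' : (0 : ℝ) < n := by exact_mod_cast hn
  have hd' : (0 : ℝ) < d := by exact_mod_cast hd
  have h5 : 2 * r * d ≤ 2 * n + d := by nlinarith
  have h6 : 2 * n ≤ 2 * r * d + d := by nlinarith
  have h7 : (2 * r * d : ℝ) ≤ 2 * n + d := by exact_mod_cast h5
  have h8 : (2 * n : ℝ) ≤ 2 * r * d + d := by exact_mod_cast h6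
  rw [div_sub_div _ _ hn'.ne' hd'.ne', abs_le, neg_div',
    div_le_div_iff₀ (by positivity) (by positivity),
    div_le_div_iff₀ (by positivity) (by positivity)]
  constructor <;> nlinarith

lemma floor_div_le (n d : ℕ) :
    (((2 * n / d + 1) / 2 : ℕ) : ℝ) / n ≤ 2 / d := by
  rcases Nat.eq_zero_or_pos n with rfl | hn
  · simp only [CharP.cast_eq_zero, div_zero]
    positivity
  rcases Nat.eq_zero_or_pos d with rfl | hd
  · simp
  rw [div_le_div_iff₀ (by positivity) (by positivity)]
  have h1 : (2 * n / d + 1) / 2 ≤ 2 * n / d := by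
    generalize 2 * n / d = q
    omega
  exact_mod_cast (Nat.mul_le_mul_right d h1).trans (Nat.div_mul_le_self _ _)

theorem phi_sum_4k_sub_2_limit :
    Tendsto (fun n : ℕ =>
        (∑ k ∈ Finset.Icc 1 n, (Nat.totient (4 * k - 2) : ℝ)) / (4 * (n : ℝ)) ^ 2)
      atTop (nhds (1 / (2 * π ^ 2))) := by
  let c : ℕ → ℝ := fun d ↦ if Odd d then (ArithmeticFunction.moebius d : ℝ) else 0
  have hc : ∀ d, ‖c d‖ ≤ 1 := by
    intro d
    simp only [c]
    split_ifs
    · rw [Real.norm_eq_abs]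
      exact_mod_cast ArithmeticFunction.abs_moebius_le_one
    · simp
  have hlim : Tendsto
      (fun n : ℕ ↦ ∑' d : ℕ, c d * ((((2 * n / d + 1) / 2 : ℕ) : ℝ) / n) ^ 2) atTop
      (nhds (∑' d : ℕ, c d / (d : ℝ) ^ 2)) := by
    refine tendsto_tsum_of_dominated_convergence (bound := fun d : ℕ ↦ 4 * (1 / (d : ℝ) ^ 2))
      (hasSum_zeta_two.summable.mul_left 4) (fun d ↦ ?_) (.of_forall fun n d ↦ ?_)
    · rcases Nat.eq_zero_or_pos d with rfl | hd
      · simp [c]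
      have h : Tendsto (fun n : ℕ ↦ (((2 * n / d + 1) / 2 : ℕ) : ℝ) / n) atTop
          (nhds (1 / (d : ℝ))) := by
        rw [tendsto_iff_norm_sub_tendsto_zero]
        refine squeeze_zero' (.of_forall fun _ ↦ norm_nonneg _) ?_
          tendsto_one_div_atTop_nhds_zero_nat
        filter_upwards [eventually_gt_atTop 0] with n hn using abs_floor_div_sub_le n d hn hd
      convert (h.pow 2).const_mul (c d) using 2
      ring
    · rw [norm_mul, norm_pow,
        Real.norm_of_nonneg (r := (((2 * n / d + 1) / 2 : ℕ) : ℝ) / n) (by positivity)]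
      calc _ ≤ 1 * (2 / (d : ℝ)) ^ 2 := by
            refine mul_le_mul (hc d) ?_ (by positivity) zero_le_one
            exact pow_le_pow_left₀ (by positivity) (floor_div_le n d) 2
        _ = _ := by ring
  rw [tsum_odd_moebius_div_sq] at hlim
  convert hlim.div_const 16 using 2 with n
  · rw [sum_totient_four_mul_sub_two, sum_totient_odd, tsum_eq_sum (s := Ioc 0 (2 * n)),
      sum_div, sum_div]
    · refine sum_congr rfl fun d _ ↦ ?_
      simp only [c]
      ring
    · intro d hd
      rcases Nat.eq_zero_or_pos d with rfl | hd'
      · simp [c]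
      · have : 2 * n / d = 0 := Nat.div_eq_of_lt (by simp at hd; omega)
        simp [this]
  · ring
end

section
/- The limit as n → ∞ of (∑_{k=1}^n φ(4k)) / (4n)² equals 1 / (2π²). -/
open Filter Finset Real

/-- The Möbius function restricted to odd arguments, with real values. -/
noncomputable def oddMoebius : ArithmeticFunction ℝ where
  toFun d := if Odd d then (ArithmeticFunction.moebius d : ℝ) else 0
  map_zero' := by simp

theorem oddMoebius_apply (d : ℕ) :
    oddMoebius d = if Odd d then (ArithmeticFunction.moebius d : ℝ) else 0 := rfl

theorem abs_oddMoebius_le_one (d : ℕ) : |oddMoebius d| ≤ 1 := by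
  rw [oddMoebius_apply]
  split_ifs
  · exact_mod_cast ArithmeticFunction.abs_moebius_le_one
  · simp

theorem totient_two_pow_succ_mul {a m : ℕ} (hm : Odd m) :
    (2 ^ (a + 1) * m).totient = 2 ^ a * m.totient := by
  rw [Nat.totient_mul (Nat.Coprime.pow_left _ (Nat.coprime_two_left.2 hm)),
    Nat.totient_prime_pow_succ Nat.prime_two]
  simp

theorem totient_eq_sum_divisors_moebius {m : ℕ} (hm : 0 < m) :
    (m.totient : ℝ) = ∑ d ∈ m.divisors, (ArithmeticFunction.moebius d : ℝ) * (m / d : ℕ) := by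
  have h := (ArithmeticFunction.sum_eq_iff_sum_mul_moebius_eq
    (f := fun n => (n.totient : ℝ)) (g := fun n => (n : ℝ))).1
    (fun n _ => by exact_mod_cast Nat.sum_totient n) m hm
  rw [← h]
  exact Nat.sum_divisorsAntidiagonal
    (fun i j => (ArithmeticFunction.moebius i : ℝ) * (j : ℝ))

theorem filter_odd_divisors_two_pow_mul {a m : ℕ} (hm : Odd m) :
    {d ∈ (2 ^ a * m).divisors | Odd d} = m.divisors := by
  ext d
  simp only [mem_filter, Nat.mem_divisors]
  constructor
  · rintro ⟨⟨h, -⟩, ho⟩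
    exact ⟨(Nat.Coprime.pow_right a (Nat.coprime_two_right.2 ho)).dvd_of_dvd_mul_left h, hm.pos.ne'⟩
  · rintro ⟨h, -⟩
    exact ⟨⟨h.mul_left _, (Nat.mul_pos (by positivity) hm.pos).ne'⟩, hm.of_dvd_nat h⟩

theorem oddMoebius_mul_id_apply {k : ℕ} (hk : 0 < k) :
    (oddMoebius * (ArithmeticFunction.id : ArithmeticFunction ℝ)) k = ((2 * k).totient : ℝ) := by
  obtain ⟨a, m, hm, rfl⟩ := Nat.exists_eq_two_pow_mul_odd hk.ne'
  rw [ArithmeticFunction.mul_apply, ← mul_assoc, ← pow_succ', totient_two_pow_succ_mul hm,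
    Nat.cast_mul, totient_eq_sum_divisors_moebius hm.pos, Finset.mul_sum]
  refine (Nat.sum_divisorsAntidiagonal (fun i j => oddMoebius i *
    (ArithmeticFunction.id : ArithmeticFunction ℝ) j)).trans ?_
  simp only [oddMoebius_apply, ite_mul, zero_mul]
  rw [← Finset.sum_filter, filter_odd_divisors_two_pow_mul hm]
  refine Finset.sum_congr rfl fun d hd => ?_
  rw [Nat.mul_div_assoc _ (Nat.dvd_of_mem_divisors hd)]
  simp
  ring

theorem LSeries_trivChar_two :
    LSeries (fun n => (1 : DirichletCharacter ℂ 2) n) 2 = π ^ 2 / 8 := by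
  rw [← DirichletCharacter.LFunction_eq_LSeries _ (by simp)]
  refine (DirichletCharacter.LFunctionTrivChar_eq_mul_riemannZeta (N := 2) (by norm_num)).trans ?_
  rw [riemannZeta_two, Nat.prime_two.primeFactors, Finset.prod_singleton, Complex.cpow_neg]
  norm_num
  ring

theorem tsum_oddMoebius_div_sq : ∑' d : ℕ, oddMoebius d / (d : ℝ) ^ 2 = 8 / π ^ 2 := by
  have h := DirichletCharacter.LSeries.mul_mu_eq_one (1 : DirichletCharacter ℂ 2)
    (s := 2) (by simp)
  rw [LSeries_trivChar_two] at h
  have hL : LSeries ((fun n : ℕ => (1 : DirichletCharacter ℂ 2) n) *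
      fun n => (ArithmeticFunction.moebius n : ℂ)) 2 =
      ((∑' d : ℕ, oddMoebius d / (d : ℝ) ^ 2 : ℝ) : ℂ) := by
    rw [LSeries, Complex.ofReal_tsum]
    refine tsum_congr fun d => ?_
    rcases eq_or_ne d 0 with rfl | hd
    · simp
    rw [LSeries.term_of_ne_zero hd, oddMoebius_apply, Pi.mul_apply]
    by_cases ho : Odd d
    · rw [MulChar.one_apply ((ZMod.isUnit_iff_coprime d 2).2 (Nat.coprime_two_right.2 ho))]
      simp [ho]
    · rw [MulChar.map_nonunit _ (fun hu => ho (Nat.coprime_two_right.1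
        ((ZMod.isUnit_iff_coprime d 2).1 hu)))]
      simp [ho]
  rw [hL] at h
  have hr : π ^ 2 / 8 * ∑' d : ℕ, oddMoebius d / (d : ℝ) ^ 2 = 1 := by exact_mod_cast h
  have := pi_pos.ne'
  field_simp at hr ⊢
  linarith

theorem sum_Ioc_natCast (m : ℕ) : ∑ e ∈ Ioc 0 m, (e : ℝ) = m * (m + 1) / 2 := by
  induction m with
  | zero => simp
  | succ m ih =>
    rw [Finset.sum_Ioc_succ_top (Nat.zero_le m), ih]
    push_cast
    ring

theorem sum_totient_two_mul (n : ℕ) :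
    ∑ k ∈ Icc 1 n, ((2 * k).totient : ℝ) =
      ∑' d : ℕ, oddMoebius d * (((n / d : ℕ) : ℝ) * ((n / d : ℕ) + 1) / 2) := by
  have h := ArithmeticFunction.sum_Ioc_mul_eq_sum_sum oddMoebius
    (ArithmeticFunction.id : ArithmeticFunction ℝ) n
  rw [tsum_eq_sum (s := Ioc 0 n)]
  · calc _ = ∑ k ∈ Ioc 0 n,
          (oddMoebius * (ArithmeticFunction.id : ArithmeticFunction ℝ)) k :=
        Finset.sum_congr rfl fun k hk =>
          (oddMoebius_mul_id_apply (mem_Icc.1 hk).1).symm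
      _ = _ := by
        rw [h]
        simp [sum_Ioc_natCast]
  · intro d hd
    have : n / d = 0 := by
      rw [Nat.div_eq_zero_iff]
      simp only [mem_Ioc] at hd
      lia
    simp [this]

theorem tendsto_natDiv_div (d : ℕ) :
    Tendsto (fun n : ℕ => ((n / d : ℕ) : ℝ) / n) atTop (nhds (1 / d)) := by
  have h := (tendsto_nat_floor_mul_div_atTop (R := ℝ) (a := 1 / d) (by positivity)).comp
    tendsto_natCast_atTop_atTop
  refine h.congr fun n => ?_
  simp only [Function.comp_apply]
  rw [one_div_mul_eq_div, Nat.floor_div_eq_div]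

theorem tendsto_sum_totient_two_mul :
    Tendsto (fun n : ℕ => (∑ k ∈ Icc 1 n, ((2 * k).totient : ℝ)) / (n : ℝ) ^ 2) atTop
      (nhds (4 / π ^ 2)) := by
  have hlim : 4 / π ^ 2 = ∑' d : ℕ, oddMoebius d / (d : ℝ) ^ 2 / 2 := by
    rw [tsum_div_const, tsum_oddMoebius_div_sq]
    ring
  simp only [sum_totient_two_mul, ← tsum_div_const, hlim]
  refine tendsto_tsum_of_dominated_convergence
    (bound := fun d : ℕ => 1 / (d : ℝ) ^ 2) (summable_one_div_nat_pow.2 one_lt_two)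
    (fun d => ?_) ?_
  · have h1 := tendsto_natDiv_div d
    have h2 := h1.mul (h1.add tendsto_one_div_atTop_nhds_zero_nat)
    convert (h2.const_mul (oddMoebius d / 2)) using 2 <;> ring
  · filter_upwards [eventually_gt_atTop 0] with n hn d
    have hn' : (0 : ℝ) < n := by exact_mod_cast hn
    rcases Nat.eq_zero_or_pos d with rfl | hd
    · simp
    have hdiv : ((n / d : ℕ) : ℝ) ≤ n / d := Nat.cast_div_le
    have hm : ((n / d : ℕ) : ℝ) * ((n / d : ℕ) + 1) / 2 ≤ ((n / d : ℕ) : ℝ) ^ 2 := by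
      rcases Nat.eq_zero_or_pos (n / d) with h0 | h0
      · simp [h0]
      · have : (1 : ℝ) ≤ (n / d : ℕ) := by exact_mod_cast h0
        nlinarith
    rw [norm_eq_abs, abs_div, abs_mul, abs_of_pos (pow_pos hn' 2),
      abs_of_nonneg (a := _ / 2) (by positivity), div_le_iff₀ (pow_pos hn' 2)]
    calc |oddMoebius d| * (((n / d : ℕ) : ℝ) * ((n / d : ℕ) + 1) / 2)
        ≤ 1 * ((n : ℝ) / d) ^ 2 :=
          mul_le_mul (abs_oddMoebius_le_one d) (hm.trans (by gcongr)) (by positivity) zero_le_one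
      _ = 1 / (d : ℝ) ^ 2 * n ^ 2 := by ring

theorem phi_sum_4k_limit :
    Tendsto (fun n : ℕ =>
        (∑ k ∈ Finset.Icc 1 n, (Nat.totient (4 * k) : ℝ)) / (4 * (n : ℝ)) ^ 2)
      atTop (nhds (1 / (2 * π ^ 2))) := by
  have htot (k : ℕ) : (Nat.totient (4 * k) : ℝ) = 2 * (Nat.totient (2 * k) : ℝ) := by
    rw [show 4 * k = 2 * (2 * k) by ring, Nat.totient_two_mul_of_even (even_two_mul k)]
    push_cast
    rfl
  simp only [htot, ← Finset.mul_sum]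
  convert tendsto_sum_totient_two_mul.const_mul (1 / 8) using 2 <;> ring
end
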